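/- Let a > 0 and b, c, ζ₂, ζ₃ ∈ ℝ, and set q = a + i·b ∈ ℂ. Define G : ℝ³ × ℝ → ℂ by G(x₁,x₂,x₃,t) = (1 + 4·i·q·t)^(−1/2) · exp(−q·(x₁ − c·t)² / (1 + 4·i·q·t)) · exp(i·(c/2)·x₁ − i·(c²/4)·t) · exp(i·(ζ₂·x₂ + ζ₃·x₃) − i·(ζ₂² + ζ₃²)·t), where z^(−1/2) denotes the principal branch of the complex power. Then G satisfies the three-dimensional free Schrödinger equation i·∂ₜG + ∂²_{x₁}G + ∂²_{x₂}G + ∂²_{x₃}G = 0 at every point of ℝ³ × ℝ. -/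

import Mathlib

/-- Second derivative of a function whose logarithmic derivative is `p`. -/
theorem deriv_deriv_of_logarithmic_derivative {g p : ℝ → ℂ} {p' : ℂ} {x : ℝ}
    (hg : ∀ y, HasDerivAt g (p y * g y) y) (hp : HasDerivAt p p' x) :
    deriv (deriv g) x = (p' + p x ^ 2) * g x := by
  have h : deriv g = fun y => p y * g y := funext fun y => (hg y).deriv
  rw [h, (hp.fun_mul (hg x)).deriv]
  ring

/-- The complex width `1 + 4 i q t` of a Gaussian with `Re q > 0` avoids the branch cut. -/
theorem one_add_four_I_mul_mem_slitPlane {q : ℂ} (hq : 0 < q.re) (t : ℝ) :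
    1 + 4 * Complex.I * q * (t : ℂ) ∈ Complex.slitPlane := by
  rw [Complex.mem_slitPlane_iff]
  rcases eq_or_ne t 0 with rfl | ht
  · simp
  · right
    simp [hq.ne', ht]


/-- The three-dimensional Fourier-Chirped-Gaussian profile solves the three-dimensional
free Schrödinger equation `i ∂ₜG + ∂²_{x₁}G + ∂²_{x₂}G + ∂²_{x₃}G = 0`. -/
theorem stmt4 (a b c ζ₂ ζ₃ : ℝ) (ha : 0 < a) (q : ℂ)
    (hq : q = (a : ℂ) + Complex.I * (b : ℂ))
    (G : ℝ → ℝ → ℝ → ℝ → ℂ)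
    (hG : ∀ x₁ x₂ x₃ t : ℝ, G x₁ x₂ x₃ t =
      (1 + 4 * Complex.I * q * (t : ℂ)) ^ (-(1/2) : ℂ) *
        Complex.exp (-q * ((x₁ : ℂ) - (c : ℂ) * (t : ℂ)) ^ 2 /
          (1 + 4 * Complex.I * q * (t : ℂ))) *
        Complex.exp (Complex.I * ((c : ℂ) / 2) * (x₁ : ℂ) -
          Complex.I * ((c : ℂ) ^ 2 / 4) * (t : ℂ)) *
        Complex.exp (Complex.I * ((ζ₂ : ℂ) * (x₂ : ℂ) + (ζ₃ : ℂ) * (x₃ : ℂ)) -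
          Complex.I * ((ζ₂ : ℂ) ^ 2 + (ζ₃ : ℂ) ^ 2) * (t : ℂ))) :
    ∀ x₁ x₂ x₃ t : ℝ,
      Complex.I * deriv (fun τ : ℝ => G x₁ x₂ x₃ τ) t +
        deriv (deriv (fun ξ : ℝ => G ξ x₂ x₃ t)) x₁ +
        deriv (deriv (fun υ : ℝ => G x₁ υ x₃ t)) x₂ +
        deriv (deriv (fun σ : ℝ => G x₁ x₂ σ t)) x₃ = 0 := by
  intro x₁ x₂ x₃ t
  have hre : 0 < q.re := by simpa [hq] using ha
  have hslit := one_add_four_I_mul_mem_slitPlane hre t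
  have hne := Complex.slitPlane_ne_zero hslit
  have hcast (y : ℝ) : HasDerivAt (fun s : ℝ => (s : ℂ)) 1 y := Complex.ofRealCLM.hasDerivAt
  have hx₁ (y : ℝ) : HasDerivAt (fun ξ : ℝ => G ξ x₂ x₃ t)
      ((-2 * q * ((y : ℂ) - c * t) / (1 + 4 * Complex.I * q * t) + Complex.I * (c / 2)) *
        G y x₂ x₃ t) y := by
    simp only [hG]
    refine HasDerivAt.congr_deriv ((((((((hcast y).sub_const ((c : ℂ) * t)).pow 2).const_mul (-q)).div_const
      (1 + 4 * Complex.I * q * t)).cexp.const_mul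
        ((1 + 4 * Complex.I * q * (t : ℂ)) ^ (-(1/2) : ℂ))).mul
      (((hcast y).const_mul (Complex.I * ((c : ℂ) / 2))).sub_const
        (Complex.I * ((c : ℂ) ^ 2 / 4) * t)).cexp).mul_const
      (Complex.exp (Complex.I * ((ζ₂ : ℂ) * x₂ + ζ₃ * x₃) -
        Complex.I * ((ζ₂ : ℂ) ^ 2 + (ζ₃ : ℂ) ^ 2) * t))) ?_
    simp only [Pi.pow_apply]
    push_cast
    ring
  have hx₂ (y : ℝ) : HasDerivAt (fun υ : ℝ => G x₁ υ x₃ t)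
      (Complex.I * ζ₂ * G x₁ y x₃ t) y := by
    simp only [hG]
    refine HasDerivAt.congr_deriv (((((((hcast y).const_mul (ζ₂ : ℂ)).add_const ((ζ₃ : ℂ) * x₃)).const_mul
      Complex.I).sub_const (Complex.I * ((ζ₂ : ℂ) ^ 2 + (ζ₃ : ℂ) ^ 2) * t)).cexp).const_mul
      _) ?_
    ring
  have hx₃ (y : ℝ) : HasDerivAt (fun σ : ℝ => G x₁ x₂ σ t)
      (Complex.I * ζ₃ * G x₁ x₂ y t) y := by
    simp only [hG]
    refine HasDerivAt.congr_deriv (((((((hcast y).const_mul (ζ₃ : ℂ)).const_add ((ζ₂ : ℂ) * x₂)).const_mul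
      Complex.I).sub_const (Complex.I * ((ζ₂ : ℂ) ^ 2 + (ζ₃ : ℂ) ^ 2) * t)).cexp).const_mul
      _) ?_
    ring
  have ht : HasDerivAt (fun τ : ℝ => G x₁ x₂ x₃ τ)
      ((-2 * Complex.I * q / (1 + 4 * Complex.I * q * t) +
        2 * q * c * ((x₁ : ℂ) - c * t) / (1 + 4 * Complex.I * q * t) +
        4 * Complex.I * q ^ 2 * ((x₁ : ℂ) - c * t) ^ 2 / (1 + 4 * Complex.I * q * t) ^ 2 -
        Complex.I * (c ^ 2 / 4) - Complex.I * (ζ₂ ^ 2 + ζ₃ ^ 2)) * G x₁ x₂ x₃ t) t := by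
    simp only [hG]
    have hwidth : HasDerivAt (fun τ : ℝ => 1 + 4 * Complex.I * q * (τ : ℂ))
        (4 * Complex.I * q) t := by
      simpa using ((hcast t).const_mul (4 * Complex.I * q)).const_add 1
    have hphase (A B : ℂ) : HasDerivAt (fun τ : ℝ => Complex.exp (A - B * (τ : ℂ)))
        (Complex.exp (A - B * t) * -B) t := by
      simpa using (((hcast t).const_mul B).const_sub A).cexp
    have hpow : HasDerivAt (fun τ : ℝ => (1 + 4 * Complex.I * q * (τ : ℂ)) ^ (-(1/2) : ℂ))
        (-2 * Complex.I * q / (1 + 4 * Complex.I * q * t) *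
          (1 + 4 * Complex.I * q * (t : ℂ)) ^ (-(1/2) : ℂ)) t := by
      refine ((Complex.hasStrictDerivAt_cpow_const hslit).hasDerivAt.comp t hwidth).congr_deriv ?_
      rw [Complex.cpow_sub _ _ hne, Complex.cpow_one]
      ring
    have hgauss := ((((((hcast t).const_mul (c : ℂ)).const_sub (x₁ : ℂ)).pow 2).const_mul
      (-q)).div hwidth hne).cexp
    refine HasDerivAt.congr_deriv (((hpow.mul hgauss).mul (hphase _ _)).mul (hphase _ _)) ?_
    simp only [Pi.pow_apply, Pi.mul_apply, Pi.div_apply]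
    push_cast
    field_simp
    ring
  have hp : HasDerivAt (fun y : ℝ => -2 * q * ((y : ℂ) - c * t) / (1 + 4 * Complex.I * q * t) +
      Complex.I * (c / 2)) (-2 * q / (1 + 4 * Complex.I * q * t)) x₁ := by
    simpa using ((((hcast x₁).sub_const ((c : ℂ) * t)).const_mul (-2 * q)).div_const
      (1 + 4 * Complex.I * q * t)).add_const (Complex.I * ((c : ℂ) / 2))
  rw [ht.deriv, deriv_deriv_of_logarithmic_derivative hx₁ hp,
    deriv_deriv_of_logarithmic_derivative hx₂ (hasDerivAt_const _ _),
    deriv_deriv_of_logarithmic_derivative hx₃ (hasDerivAt_const _ _)]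
  generalize 1 + 4 * Complex.I * q * (t : ℂ) = D
  linear_combination (-2 * q / D + 4 * q ^ 2 * ((x₁ : ℂ) - c * t) ^ 2 / D ^ 2) *
    G x₁ x₂ x₃ t * Complex.I_sq
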